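/- If the discrete polymatroid nD is representable over F_q, then for every extension field F_{q'} of F_q of size q' > N(D), a perfect linear index coding solution of dimension n exists over F_{q'} for the index coding problem I^D(Z,R) constructed from D. -/

import Mathlib

open scoped Classical

/-- Sum of the components of `u` indexed by the elements of `A`. -/
noncomputable def setSum {r : ℕ} (u : Fin r → ℕ) (A : Set (Fin r)) : ℕ :=
  ∑ i ∈ Finset.univ.filter (· ∈ A), u i

/-- A discrete polymatroid on the ground set `{1,…,r}` (modelled as `Fin r`). -/
structure DiscretePolymatroid (r : ℕ) where
  carrier : Set (Fin r → ℕ)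
  nonempty : carrier.Nonempty
  finite : carrier.Finite
  lower : ∀ u ∈ carrier, ∀ v : Fin r → ℕ, (∀ i, v i ≤ u i) → v ∈ carrier
  exchange : ∀ u ∈ carrier, ∀ v ∈ carrier, (∑ i, u i) < (∑ i, v i) →
    ∃ w ∈ carrier, (∀ i, u i ≤ w i) ∧ u ≠ w ∧ ∀ i, w i ≤ max (u i) (v i)

namespace DiscretePolymatroid

variable {r : ℕ} (D : DiscretePolymatroid r)

/-- The rank function of a discrete polymatroid. -/
noncomputable def rho (A : Set (Fin r)) : ℕ :=
  D.finite.toFinset.sup fun u => setSum u A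

/-- `ρ_max(D) = max_i ρ({i})`. -/
noncomputable def rhoMax : ℕ := Finset.univ.sup fun i : Fin r => D.rho {i}

/-- The rank of the discrete polymatroid (the common component sum of its basis vectors). -/
noncomputable def rank : ℕ := D.rho Set.univ

end DiscretePolymatroid

/-- The subspaces `V i` of `F^d` represent the rank function `ρ'` when
`dim (∑_{i ∈ X} V i) = ρ'(X)` for every `X`. -/
def RepFnOver (r : ℕ) (ρ' : Set (Fin r) → ℕ) (F : Type) [Field F] : Prop :=
  ∃ (d : ℕ) (V : Fin r → Submodule F (Fin d → F)),
    ∀ X : Set (Fin r), Module.finrank F ↥(⨆ i ∈ X, V i) = ρ' X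

/-- A discrete polymatroid is representable over `F` if its rank function is. -/
def DiscretePolymatroid.RepresentableOver {r : ℕ} (D : DiscretePolymatroid r)
    (F : Type) [Field F] : Prop :=
  RepFnOver r D.rho F


/-- An index coding problem with message index type `M`: a receiver `(x, H)` demands the
message `x` and has the set of messages `H` as side information. -/
structure IndexProblem (M : Type) where
  recv : Set (M × Set M)

/-- A linear index coding solution over `F` of length `c` and dimension `n`: each message is
a row vector of length `n` over `F`, the encoding map `f` is linear, and every receiver can
recover its demanded message from its side information and `f(y)` by a linear decoding map. -/
def HasLinearIndexCode {M : Type} (P : IndexProblem M) (F : Type) [Field F]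
    (n c : ℕ) : Prop :=
  ∃ f : ((M → Fin n → F) →ₗ[F] (Fin c → F)),
    ∀ p ∈ P.recv, ∃ ψ : ((↥p.2 → Fin n → F) × (Fin c → F)) →ₗ[F] (Fin n → F),
      ∀ y : M → Fin n → F, ψ (fun j => y j.1, f y) = y p.1

namespace DiscretePolymatroid

variable {r : ℕ} (D : DiscretePolymatroid r)

/-- A basis vector of a discrete polymatroid: a maximal element of the carrier. -/
def IsBasisVec (b : Fin r → ℕ) : Prop :=
  b ∈ D.carrier ∧ ∀ u ∈ D.carrier, (∀ i, b i ≤ u i) → u = b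

/-- An excluded vector of a discrete polymatroid. -/
def IsExcluded (u : Fin r → ℕ) : Prop :=
  (∀ i, u i ≤ D.rho {i}) ∧ u ∉ D.carrier

/-- A minimal excluded vector of a discrete polymatroid. -/
def IsMinExcluded (u : Fin r → ℕ) : Prop :=
  D.IsExcluded u ∧ ∀ v, D.IsExcluded v → (∀ i, v i ≤ u i) → v = u

/-- The message index type of the index coding problem `I^D(Z,R)`:
`Sum.inl j` is the message `x_j` (`j ∈ {1,…,rank D}`), and `Sum.inr ⟨i,p⟩` is the message
`y_i^p` (`i ∈ {1,…,r}`, `p ∈ {1,…,ρ({i})}`). -/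
@[reducible] noncomputable def Msg : Type :=
  Fin D.rank ⊕ (Σ i : Fin r, Fin (D.rho {i}))

/-- The number of elements of a subset `T` of `Y` lying in `ζ_l = {y_l^1,…,y_l^{ρ({l})}}`. -/
noncomputable def sliceCard (T : Set (Σ i : Fin r, Fin (D.rho {i}))) (l : Fin r) : ℕ :=
  {p : Fin (D.rho {l}) | (⟨l, p⟩ : Σ i : Fin r, Fin (D.rho {i})) ∈ T}.ncard

/-- The index coding problem `I^D(Z,R)` constructed from the discrete polymatroid `D`,
with receiver set `R = R1 ∪ R2 ∪ R3`. -/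
noncomputable def indexProblem : IndexProblem D.Msg where
  recv :=
    -- R1
    {pr | ∃ b : Fin r → ℕ, D.IsBasisVec b ∧ ∃ j : Fin D.rank,
        ∃ T : Set (Σ i : Fin r, Fin (D.rho {i})),
          (∀ l : Fin r, D.sliceCard T l = b l) ∧
          pr = (Sum.inl j, Sum.inr '' T)} ∪
    -- R2
    {pr | ∃ c : Fin r → ℕ, D.IsMinExcluded c ∧ ∃ j : Fin r, c j ≠ 0 ∧
        ∃ p : Fin (D.rho {j}), ∃ T : Set (Σ i : Fin r, Fin (D.rho {i})),
          (∀ l : Fin r, l ≠ j → D.sliceCard T l = c l) ∧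
          D.sliceCard T j = c j - 1 ∧
          (⟨j, p⟩ : Σ i : Fin r, Fin (D.rho {i})) ∉ T ∧
          pr = (Sum.inr ⟨j, p⟩, Sum.inr '' T)} ∪
    -- R3
    {pr | ∃ (i : Fin r) (p : Fin (D.rho {i})),
        pr = (Sum.inr ⟨i, p⟩, Set.range Sum.inl)}

/-- `M(I^D(Z,R)) = ∑_{i=1}^r ρ({i})`: a perfect solution of dimension `n` has length
`n * indexCodeLen`. -/
noncomputable def indexCodeLen : ℕ := ∑ i : Fin r, D.rho {i}

/-- The bound `N(D)` on the field size. -/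
noncomputable def Nbound : ℕ :=
  1 + Finset.univ.sup fun i : Fin r =>
    ∑ b ∈ D.finite.toFinset.filter (fun b => D.IsBasisVec b ∧ 0 < b i),
      Nat.choose (D.rho {i}) (b i - 1) *
        ∏ j ∈ (Finset.univ.filter fun j : Fin r => b j ≠ 0).erase i,
          Nat.choose (D.rho {j}) (b j)

end DiscretePolymatroid

section LinearAlgebra

open Module

variable {K W ι : Type*} [Field K] [AddCommGroup W] [Module K W]

/-- A linear map factors through any linear map with smaller kernel. -/
theorem LinearMap.exists_eq_comp_of_ker_le {A B : Type*} [AddCommGroup A] [Module K A]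
    [AddCommGroup B] [Module K B] (g : W →ₗ[K] A) (h : W →ₗ[K] B)
    (hgh : ∀ y, g y = 0 → h y = 0) : ∃ ψ : A →ₗ[K] B, ∀ y, ψ (g y) = h y := by
  have hle : LinearMap.ker g ≤ LinearMap.ker h := fun y hy => hgh y hy
  obtain ⟨s, hs⟩ := ((LinearMap.ker g).liftQ g le_rfl).exists_leftInverse_of_injective
    (Submodule.ker_liftQ_eq_bot _ _ _ le_rfl)
  refine ⟨((LinearMap.ker g).liftQ h hle) ∘ₗ s, fun y => ?_⟩
  have := LinearMap.congr_fun hs (Submodule.Quotient.mk y)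
  simp only [LinearMap.comp_apply, LinearMap.id_apply, Submodule.liftQ_apply] at this ⊢
  rw [this, Submodule.liftQ_apply]

theorem Submodule.exists_retraction (U : Submodule K W) :
    ∃ π : W →ₗ[K] U, ∀ u : U, π u = u := by
  obtain ⟨π, hπ⟩ := U.subtype.exists_leftInverse_of_injective U.ker_subtype
  exact ⟨π, fun u => LinearMap.congr_fun hπ u⟩

/-- Over a finite field, a space is not covered by fewer subspaces not containing it than there
are scalars. -/
theorem Submodule.exists_mem_forall_notMem_of_card_lt [Fintype K] [FiniteDimensional K W]
    (V : Submodule K W) (s : Finset ι) (H : ι → Submodule K W)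
    (hH : ∀ t ∈ s, ¬ V ≤ H t) (hs : s.card < Fintype.card K) :
    ∃ v ∈ V, ∀ t ∈ s, v ∉ H t := by
  by_contra! hcon
  have : Finite W := Module.finite_of_finite K
  have : Fintype W := Fintype.ofFinite W
  have hsub : (Finset.univ.filter (· ∈ V)) ⊆
      s.biUnion fun t => Finset.univ.filter (· ∈ V ⊓ H t) := by
    intro v hv
    obtain ⟨t, ht, hvt⟩ := hcon v (by simpa using hv)
    simp only [Finset.mem_biUnion, Finset.mem_filter, Finset.mem_univ, true_and] at hv ⊢
    exact ⟨t, ht, hv, hvt⟩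
  have hcard : ∀ U : Submodule K W, (Finset.univ.filter (· ∈ U)).card =
      Fintype.card K ^ finrank K U := fun U => by
    rw [← Module.card_eq_pow_finrank, Fintype.card_subtype]
  have hlt : ∀ t ∈ s, Fintype.card K * (Finset.univ.filter (· ∈ V ⊓ H t)).card ≤
      (Finset.univ.filter (· ∈ V)).card := by
    intro t ht
    rw [hcard, hcard, ← pow_succ']
    refine Nat.pow_le_pow_right Fintype.card_pos (Submodule.finrank_lt_finrank_of_lt ?_)
    exact lt_of_le_of_ne inf_le_left fun h => hH t ht (inf_eq_left.mp h)
  have h1 := (Finset.card_le_card hsub).trans Finset.card_biUnion_le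
  have h2 := (Nat.mul_le_mul_left (Fintype.card K) h1)
  rw [Finset.mul_sum] at h2
  have h3 := h2.trans (Finset.sum_le_card_nsmul _ _ _ hlt)
  rw [smul_eq_mul] at h3
  have hpos : 0 < (Finset.univ.filter (· ∈ V)).card :=
    Finset.card_pos.mpr ⟨0, by simp⟩
  exact absurd (Nat.le_of_mul_le_mul_right h3 hpos) (by omega)

/-- A subspace of dimension at least two is the sum of two proper subspaces. -/
theorem Submodule.exists_sup_eq_of_two_le_finrank [FiniteDimensional K W] (V : Submodule K W)
    (hV : 2 ≤ finrank K V) : ∃ H₁ H₂ : Submodule K W, H₁ < V ∧ H₂ < V ∧ H₁ ⊔ H₂ = V := by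
  obtain ⟨v, hvV, hv⟩ := V.exists_mem_ne_zero_of_ne_bot (by rintro rfl; simp at hV)
  have hle : K ∙ v ≤ V := (Submodule.span_singleton_le_iff_mem _ _).mpr hvV
  obtain ⟨C, hC⟩ := exists_isCompl (K ∙ v)
  refine ⟨K ∙ v, C ⊓ V, lt_of_le_of_ne hle ?_, lt_of_le_of_ne inf_le_right ?_, ?_⟩
  · intro h
    rw [← h, finrank_span_singleton hv] at hV
    omega
  · intro h
    have hvC : v ∈ C := (inf_eq_right.mp h) hvV
    have : v ∈ (K ∙ v) ⊓ C := ⟨Submodule.mem_span_singleton_self v, hvC⟩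
    rw [hC.inf_eq_bot] at this
    exact hv (by simpa using this)
  · rw [← sup_inf_assoc_of_le _ hle, hC.sup_eq_top, top_inf_eq]

/-- **Rado's theorem** for families of subspaces. -/
theorem exists_linearIndepOn_of_card_le_finrank [FiniteDimensional K W] (T : Finset ι)
    (V : ι → Submodule K W)
    (hV : ∀ S ⊆ T, S.card ≤ finrank K ↥(⨆ e ∈ S, V e)) :
    ∃ w : ι → W, (∀ e, w e ∈ V e) ∧ LinearIndepOn K w (T : Set ι) := by
  induction hm : ∑ e ∈ T, finrank K (V e) using Nat.strong_induction_on generalizing V with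
  | _ m ih =>
  by_cases hdim : ∃ e ∈ T, 2 ≤ finrank K (V e)
  · obtain ⟨e, heT, he⟩ := hdim
    obtain ⟨H₁, H₂, h₁, h₂, hsup⟩ := (V e).exists_sup_eq_of_two_le_finrank he
    have key : ∀ H < V e, (∀ S ⊆ T, S.card ≤ finrank K ↥(⨆ i ∈ S, Function.update V e H i)) →
        ∃ w : ι → W, (∀ e, w e ∈ V e) ∧ LinearIndepOn K w (T : Set ι) := by
      intro H hH hS
      have hle : ∀ i, Function.update V e H i ≤ V i := update_le_self_iff.mpr hH.le
      have hlt : ∑ i ∈ T, finrank K (Function.update V e H i) < m := by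
        rw [← hm]
        refine Finset.sum_lt_sum (fun i _ => Submodule.finrank_mono (hle i)) ⟨e, heT, ?_⟩
        exact Submodule.finrank_lt_finrank_of_lt (by simpa using hH)
      obtain ⟨w, hw, hind⟩ := ih _ hlt (Function.update V e H) hS rfl
      exact ⟨w, fun i => hle i (hw i), hind⟩
    have viol : ∀ H, (¬ ∀ S ⊆ T, S.card ≤ finrank K ↥(⨆ i ∈ S, Function.update V e H i)) →
        ∃ S ⊆ T, e ∉ S ∧ finrank K ↥(H ⊔ ⨆ i ∈ S, V i) ≤ S.card := by
      intro H hH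
      push Not at hH
      obtain ⟨S, hST, hS⟩ := hH
      have hcongr : ∀ S' : Finset ι, e ∉ S' →
          (⨆ i ∈ S', Function.update V e H i) = ⨆ i ∈ S', V i := fun S' heS' =>
        biSup_congr fun i hi => Function.update_of_ne (by rintro rfl; exact heS' hi) _ _
      have heS : e ∈ S := by
        by_contra heS
        rw [hcongr S heS] at hS
        exact absurd (hV S hST) (by omega)
      refine ⟨S.erase e, (S.erase_subset e).trans hST, S.notMem_erase e, ?_⟩
      rw [← hcongr _ (S.notMem_erase e)]
      have : (⨆ i ∈ S, Function.update V e H i) =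
          H ⊔ ⨆ i ∈ S.erase e, Function.update V e H i := by
        conv_lhs => rw [← Finset.insert_erase heS]
        rw [Finset.iSup_insert]
        simp
      rw [← this, Finset.card_erase_of_mem heS]
      omega
    by_cases hc₁ : ∀ S ⊆ T, S.card ≤ finrank K ↥(⨆ i ∈ S, Function.update V e H₁ i)
    · exact key H₁ h₁ hc₁
    by_cases hc₂ : ∀ S ⊆ T, S.card ≤ finrank K ↥(⨆ i ∈ S, Function.update V e H₂ i)
    · exact key H₂ h₂ hc₂
    exfalso
    obtain ⟨S₁, hS₁T, he₁, hS₁⟩ := viol H₁ hc₁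
    obtain ⟨S₂, hS₂T, he₂, hS₂⟩ := viol H₂ hc₂
    have hmod := Submodule.finrank_sup_add_finrank_inf_eq
      (H₁ ⊔ ⨆ i ∈ S₁, V i) (H₂ ⊔ ⨆ i ∈ S₂, V i)
    have hun : (⨆ i ∈ insert e (S₁ ∪ S₂), V i) =
        (H₁ ⊔ ⨆ i ∈ S₁, V i) ⊔ (H₂ ⊔ ⨆ i ∈ S₂, V i) := by
      rw [Finset.iSup_insert, Finset.iSup_union, ← hsup, sup_sup_sup_comm]
    have hin : (⨆ i ∈ S₁ ∩ S₂, V i) ≤ (H₁ ⊔ ⨆ i ∈ S₁, V i) ⊓ (H₂ ⊔ ⨆ i ∈ S₂, V i) :=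
      le_inf (le_sup_of_le_right (biSup_mono fun i hi => (Finset.mem_inter.mp hi).1))
        (le_sup_of_le_right (biSup_mono fun i hi => (Finset.mem_inter.mp hi).2))
    have hun' := hV (insert e (S₁ ∪ S₂))
      (Finset.insert_subset heT (Finset.union_subset hS₁T hS₂T))
    rw [Finset.card_insert_of_notMem (by simp [he₁, he₂]), hun] at hun'
    have hin' := (hV (S₁ ∩ S₂) (Finset.inter_subset_left.trans hS₁T)).trans
      (Submodule.finrank_mono hin)
    have := Finset.card_union_add_card_inter S₁ S₂
    omega
  · push Not at hdim
    have hgen : ∀ e, ∃ v ∈ V e, e ∈ T → V e ≤ K ∙ v := by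
      intro e
      by_cases heT : e ∈ T
      · obtain ⟨v, hv⟩ := finrank_le_one_iff.mp (Nat.le_of_lt_succ (hdim e heT))
        refine ⟨v, v.2, fun _ x hx => ?_⟩
        obtain ⟨c, hc⟩ := hv ⟨x, hx⟩
        exact Submodule.mem_span_singleton.mpr ⟨c, congrArg Subtype.val hc⟩
      · exact ⟨0, zero_mem _, fun h => absurd h heT⟩
    choose w hwV hwT using hgen
    refine ⟨w, hwV, ?_⟩
    rw [LinearIndepOn, linearIndependent_iff_card_le_finrank_span]
    have hT := hV T subset_rfl
    simp only [Finset.coe_sort_coe, Fintype.card_coe]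
    refine hT.trans (Submodule.finrank_mono (iSup₂_le fun e he => (hwT e he).trans ?_))
    exact Submodule.span_mono (Set.singleton_subset_iff.mpr ⟨⟨e, he⟩, rfl⟩)

/-- Independence on `T` in terms of `T \ {e}` for an element `e` of `T`. -/
theorem linearIndepOn_iff_sdiff_singleton {T : Set ι} {e : ι} (he : e ∈ T) (f : ι → W) :
    LinearIndepOn K f T ↔
      LinearIndepOn K f (T \ {e}) ∧ f e ∉ Submodule.span K (f '' (T \ {e})) := by
  rw [← linearIndepOn_insert (by simp), Set.insert_sdiff_self_of_mem he]

/-- If each member of a collection of index sets admits an independent system of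
representatives, and every index lies in fewer members than there are scalars, then a single
system of representatives is independent on all members at once. -/
theorem exists_forall_linearIndepOn_of_card_lt [Fintype K] [FiniteDimensional K W] [Fintype ι]
    (V : ι → Submodule K W) (C : Finset (Set ι))
    (hC : ∀ T ∈ C, ∃ w : ι → W, (∀ e, w e ∈ V e) ∧ LinearIndepOn K w T)
    (hcard : ∀ e, (C.filter (e ∈ ·)).card < Fintype.card K) :
    ∃ a : ι → W, (∀ e, a e ∈ V e) ∧ ∀ T ∈ C, LinearIndepOn K a T := by
  have main : ∀ s : Finset ι, ∃ a : ι → W, (∀ e, a e ∈ V e) ∧ ∀ T ∈ C,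
      ∃ w : ι → W, (∀ e, w e ∈ V e) ∧ LinearIndepOn K w T ∧ ∀ e ∈ s, w e = a e := by
    intro s
    induction s using Finset.induction_on with
    | empty =>
      refine ⟨0, fun e => zero_mem _, fun T hT => ?_⟩
      obtain ⟨w, hw, hind⟩ := hC T hT
      exact ⟨w, hw, hind, by simp⟩
    | insert e s hes ih =>
      obtain ⟨a, ha, hw⟩ := ih
      choose! w hwV hind hagree using hw
      obtain ⟨v, hv, hvT⟩ := (V e).exists_mem_forall_notMem_of_card_lt (C.filter (e ∈ ·))
        (fun T => Submodule.span K (w T '' (T \ {e}))) (fun T hT hle => by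
          obtain ⟨hTC, heT⟩ := Finset.mem_filter.mp hT
          exact ((linearIndepOn_iff_sdiff_singleton heT _).mp (hind T hTC)).2 (hle (hwV T hTC e))) (hcard e)
      have hupd : ∀ u : ι → W, (∀ i, u i ∈ V i) → ∀ i, Function.update u e v i ∈ V i := by
        intro u hu i
        by_cases hi : i = e
        · subst hi
          simpa using hv
        · simpa [hi] using hu i
      refine ⟨Function.update a e v, hupd a ha, fun T hT =>
        ⟨Function.update (w T) e v, hupd _ (hwV T hT), ?_, ?_⟩⟩
      · have heq : Set.EqOn (w T) (Function.update (w T) e v) (T \ {e}) := fun i hi =>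
          (Function.update_of_ne hi.2 _ _).symm
        by_cases heT : e ∈ T
        · rw [linearIndepOn_iff_sdiff_singleton heT]
          refine ⟨((hind T hT).mono Set.sdiff_subset).congr heq, ?_⟩
          rw [← heq.image_eq, Function.update_self]
          exact hvT T (Finset.mem_filter.mpr ⟨hT, heT⟩)
        · rw [Set.sdiff_singleton_eq_self heT] at heq
          exact (hind T hT).congr heq
      · intro i hi
        by_cases hie : i = e
        · subst hie
          simp
        · simpa [hie] using hagree T hT i (Finset.mem_of_mem_insert_of_ne hi hie)
  obtain ⟨a, ha, hw⟩ := main Finset.univ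
  refine ⟨a, ha, fun T hT => ?_⟩
  obtain ⟨w, -, hind, hagree⟩ := hw T hT
  exact hind.congr fun e _ => hagree e (Finset.mem_univ e)

open TensorProduct in
/-- Base change of subspaces along a field extension preserves the dimensions of all sums. -/
theorem finrank_iSup_baseChange {K' : Type*} [Field K'] [Algebra K K'] [FiniteDimensional K W]
    (V : ι → Submodule K W) (X : Set ι) :
    finrank K' ↥(⨆ i ∈ X, (V i).baseChange K') = finrank K ↥(⨆ i ∈ X, V i) := by
  have : (⨆ i ∈ X, (V i).baseChange K') = (⨆ i ∈ X, V i).baseChange K' := by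
    refine le_antisymm (iSup₂_le fun i hi =>
      Submodule.baseChange_mono K' (le_iSup₂_of_le i hi le_rfl)) ?_
    rw [Submodule.baseChange_eq_span, Submodule.span_le]
    rintro _ ⟨m, hm, rfl⟩
    have : (⨆ i ∈ X, V i) ≤ ((⨆ i ∈ X, (V i).baseChange K').restrictScalars K).comap
        (TensorProduct.mk K K' W 1) := iSup₂_le fun i hi m hm =>
      (le_iSup₂_of_le (f := fun i (_ : i ∈ X) => (V i).baseChange K') i hi le_rfl)
        (Submodule.tmul_mem_baseChange_of_mem 1 hm)
    exact this hm
  rw [this, ← (Submodule.toBaseChange.toLinearEquiv K' (⨆ i ∈ X, V i)).finrank_eq,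
    Module.finrank_baseChange]

end LinearAlgebra

/-- A linear index code may be given by an encoder indexed by any type of the right size, and
decodability only needs to be checked on the kernel of the encoder. -/
theorem hasLinearIndexCode_of_forall_eq_zero {M : Type} (P : IndexProblem M) (F : Type) [Field F]
    {n c : ℕ} {E : Type} [Fintype E] (hE : Fintype.card E = c)
    (f : (M → Fin n → F) →ₗ[F] (E → F))
    (hf : ∀ p ∈ P.recv, ∀ y, (∀ j ∈ p.2, y j = 0) → f y = 0 → y p.1 = 0) :
    HasLinearIndexCode P F n c := by
  let ε : (E → F) ≃ₗ[F] (Fin c → F) :=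
    LinearEquiv.funCongrLeft F F (Fintype.equivFinOfCardEq hE).symm
  refine ⟨ε.toLinearMap ∘ₗ f, fun p hp => ?_⟩
  refine LinearMap.exists_eq_comp_of_ker_le
    ((LinearMap.funLeft F (Fin n → F) ((↑) : p.2 → M)).prod (ε.toLinearMap ∘ₗ f))
    (LinearMap.proj p.1) fun y hy => ?_
  obtain ⟨h₁, h₂⟩ := Prod.mk.inj hy
  exact hf p hp y (fun j hj => congrFun h₁ ⟨j, hj⟩) (ε.map_eq_zero_iff.mp h₂)

namespace DiscretePolymatroid

variable {r : ℕ} (D : DiscretePolymatroid r)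

theorem setSum_le_rho {u : Fin r → ℕ} (hu : u ∈ D.carrier) (A : Set (Fin r)) :
    setSum u A ≤ D.rho A :=
  Finset.le_sup (f := fun u => setSum u A) (D.finite.mem_toFinset.mpr hu)

theorem apply_le_rho {u : Fin r → ℕ} (hu : u ∈ D.carrier) (i : Fin r) : u i ≤ D.rho {i} := by
  simpa [setSum, Finset.filter_eq'] using D.setSum_le_rho hu {i}

theorem exists_isBasisVec_ge {u : Fin r → ℕ} (hu : u ∈ D.carrier) :
    ∃ b, D.IsBasisVec b ∧ u ≤ b := by
  obtain ⟨b, hub, hb⟩ := D.finite.exists_le_maximal hu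
  exact ⟨b, ⟨hb.prop, fun v hv hbv => (hb.eq_of_le hv hbv).symm⟩, hub⟩

variable {D} in
/-- Basis vectors have maximal component sum. -/
theorem IsBasisVec.rank_le_sum {b : Fin r → ℕ} (hb : D.IsBasisVec b) : D.rank ≤ ∑ i, b i := by
  refine Finset.sup_le fun v hv => ?_
  simp only [setSum, Set.mem_univ, Finset.filter_true]
  by_contra! hlt
  obtain ⟨w, hw, hbw, hne, -⟩ := D.exchange b hb.1 v (D.finite.mem_toFinset.mp hv) hlt
  exact hne (hb.2 w hw hbw).symm

variable {D} in
/-- Decreasing a component of a minimal excluded vector gives a vector of the polymatroid. -/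
theorem IsMinExcluded.update_mem {c : Fin r → ℕ} (hc : D.IsMinExcluded c) {j : Fin r}
    (hj : c j ≠ 0) : Function.update c j (c j - 1) ∈ D.carrier := by
  have hle : Function.update c j (c j - 1) ≤ c := update_le_self_iff.mpr (Nat.sub_le _ _)
  by_contra hu
  have := congrFun (hc.2 _ ⟨fun i => (hle i).trans (hc.1.1 i), hu⟩ hle) j
  rw [Function.update_self] at this
  omega

theorem sum_update_sub_one {c : Fin r → ℕ} {j : Fin r} (hj : c j ≠ 0) :
    ∑ i, Function.update c j (c j - 1) i + 1 = ∑ i, c i := by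
  rw [Finset.sum_update_of_mem (Finset.mem_univ j),
    ← Finset.add_sum_erase _ _ (Finset.mem_univ j), Finset.sdiff_singleton_eq_erase]
  omega

variable {D} in
/-- A minimal excluded vector is a circuit: it exceeds the rank of its support by one. -/
theorem IsMinExcluded.rho_support_lt_sum {c : Fin r → ℕ} (hc : D.IsMinExcluded c) {j : Fin r}
    (hj : c j ≠ 0) : D.rho {l | c l ≠ 0} < ∑ i, c i := by
  have hpos : 0 < ∑ i, c i :=
    lt_of_lt_of_le (Nat.pos_of_ne_zero hj) (Finset.single_le_sum (fun _ _ => Nat.zero_le _)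
      (Finset.mem_univ j))
  refine (Finset.sup_lt_iff hpos).mpr fun v hv => ?_
  by_contra! hle
  rw [D.finite.mem_toFinset] at hv
  set v' : Fin r → ℕ := fun l => if c l ≠ 0 then v l else 0 with hv'
  have hv'D : v' ∈ D.carrier := D.lower v hv v' fun i => by
    simp only [hv']
    split_ifs <;> simp
  have hsum : setSum v {l | c l ≠ 0} = ∑ i, v' i := by
    simp only [setSum, hv', Finset.sum_filter, Set.mem_ofPred_eq]
  have hu := hc.update_mem hj
  have hus := sum_update_sub_one hj
  obtain ⟨w, hw, huw, hne, hwmax⟩ := D.exchange _ hu v' hv'D (by omega)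
  obtain ⟨l, hl⟩ : ∃ l, Function.update c j (c j - 1) l < w l := by
    by_contra! hcon
    exact hne (funext fun i => le_antisymm (huw i) (hcon i))
  by_cases hlj : l = j
  · subst hlj
    refine hc.1.2 (D.lower w hw c fun i => ?_)
    by_cases hi : i = l
    · subst hi
      rw [Function.update_self] at hl
      omega
    · simpa [hi] using huw i
  have hcl : c l ≠ 0 := by
    intro h0
    have := hwmax l
    simp only [hv', h0, Function.update_of_ne hlj] at this hl
    simp at this
    omega
  set z : Fin r → ℕ := Function.update (Function.update c j (c j - 1)) l (c l + 1) with hz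
  have hzD : z ∈ D.carrier := D.lower w hw z fun i => by
    by_cases hi : i = l
    · subst hi
      rw [Function.update_of_ne hlj] at hl
      simpa [hz] using hl
    · simpa [hz, hi] using huw i
  have hzs : ∑ i, z i = ∑ i, Function.update c j (c j - 1) i + 1 := by
    rw [hz, Finset.sum_update_of_mem (Finset.mem_univ l),
      ← Finset.add_sum_erase _ (Function.update c j (c j - 1)) (Finset.mem_univ l),
      Finset.sdiff_singleton_eq_erase, Function.update_of_ne hlj]
    omega
  have hy := hc.update_mem hcl
  have hys := sum_update_sub_one hcl
  obtain ⟨w', hw', hyw, hne', hwmax'⟩ := D.exchange _ hy z hzD (by omega)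
  obtain ⟨m, hm⟩ : ∃ m, Function.update c l (c l - 1) m < w' m := by
    by_contra! hcon
    exact hne' (funext fun i => le_antisymm (hyw i) (hcon i))
  have hml : m = l := by
    by_contra hml
    have := hwmax' m
    by_cases hmj : m = j
    · subst hmj
      simp only [hz, Function.update_of_ne hml, Function.update_self] at this hm
      omega
    · simp only [hz, Function.update_of_ne hml, Function.update_of_ne hmj] at this hm
      omega
  subst hml
  refine hc.1.2 (D.lower w' hw' c fun i => ?_)
  by_cases hi : i = m
  · subst hi
    rw [Function.update_self] at hm
    omega
  · simpa [hi] using hyw i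

/-- The indices of the elements of `T` in `ζ_l`. -/
noncomputable def slice (T : Set (Σ i : Fin r, Fin (D.rho {i}))) (l : Fin r) :
    Finset (Fin (D.rho {l})) :=
  Finset.univ.filter fun p => (⟨l, p⟩ : Σ i : Fin r, Fin (D.rho {i})) ∈ T

theorem card_slice (T : Set (Σ i : Fin r, Fin (D.rho {i}))) (l : Fin r) :
    (D.slice T l).card = D.sliceCard T l := by
  rw [sliceCard, Set.ncard_eq_toFinset_card', slice, Set.toFinset_ofPred]

theorem card_eq_sum_sliceCard (T : Set (Σ i : Fin r, Fin (D.rho {i})))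
    [DecidablePred (· ∈ T)] :
    (Finset.univ.filter (· ∈ T)).card = ∑ l, D.sliceCard T l := by
  have : Finset.univ.filter (· ∈ T) = Finset.univ.sigma (D.slice T) := by
    ext ⟨l, p⟩
    simp [slice]
  rw [this, Finset.card_sigma]
  simp only [card_slice]

/-- A set whose slice sizes form a vector of `D` extends to one whose slice sizes form a basis
vector. -/
theorem exists_superset_isBasisVec {T : Set (Σ i : Fin r, Fin (D.rho {i}))}
    (hT : D.sliceCard T ∈ D.carrier) : ∃ T', T ⊆ T' ∧ D.IsBasisVec (D.sliceCard T') := by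
  obtain ⟨b, hb, hle⟩ := D.exists_isBasisVec_ge hT
  have hex : ∀ l, ∃ s : Finset (Fin (D.rho {l})), D.slice T l ⊆ s ∧ s.card = b l := fun l => by
    obtain ⟨s, hs, -, hcard⟩ := Finset.exists_subsuperset_card_eq
      (Finset.subset_univ (D.slice T l)) ((D.card_slice T l).trans_le (hle l))
      (by simpa using D.apply_le_rho hb.1 l)
    exact ⟨s, hs, hcard⟩
  choose s hs hcard using hex
  refine ⟨{e | e.2 ∈ s e.1}, fun e he => hs e.1 (by simpa [slice] using he), ?_⟩
  convert hb
  funext l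
  rw [← card_slice, ← hcard l]
  congr 1
  ext p
  simp [slice]

/-- The number of sets with slice sizes `b` containing a given element of `ζ_i`. -/
theorem card_filter_sliceCard_eq_le (b : Fin r → ℕ) (e : Σ i : Fin r, Fin (D.rho {i})) :
    (Finset.univ.filter fun T => e ∈ T ∧ D.sliceCard T = b).card ≤
      Nat.choose (D.rho {e.1}) (b e.1 - 1) *
        ∏ j ∈ (Finset.univ.filter fun j : Fin r => b j ≠ 0).erase e.1,
          Nat.choose (D.rho {j}) (b j) := by
  have hprod : (Fintype.piFinset fun l =>
      (Finset.univ : Finset (Fin (D.rho {l}))).powersetCard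
        (Function.update b e.1 (b e.1 - 1) l)).card = Nat.choose (D.rho {e.1}) (b e.1 - 1) *
        ∏ j ∈ (Finset.univ.filter fun j : Fin r => b j ≠ 0).erase e.1,
          Nat.choose (D.rho {j}) (b j) := by
    simp only [Fintype.card_piFinset, Finset.card_powersetCard, Finset.card_univ,
      Fintype.card_fin]
    rw [← Finset.mul_prod_erase _ _ (Finset.mem_univ e.1), Function.update_self]
    congr 1
    symm
    refine (Finset.prod_subset (Finset.erase_subset_erase _ (Finset.subset_univ _))
      fun j hj hj' => ?_).trans (Finset.prod_congr rfl fun j hj => ?_)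
    · have : b j = 0 := by
        by_contra hb
        exact hj' (by simpa [hb] using hj)
      rw [this, Nat.choose_zero_right]
    · rw [Function.update_of_ne (Finset.ne_of_mem_erase hj)]
  rw [← hprod]
  refine Finset.card_le_card_of_injOn (fun T => D.slice (T \ {e})) ?_ ?_
  · intro T hT
    obtain ⟨heT, hTb⟩ := (Finset.mem_filter.mp hT).2
    simp only [Finset.mem_coe, Fintype.mem_piFinset, Finset.mem_powersetCard,
      Finset.subset_univ, true_and]
    intro l
    rw [← hTb]
    by_cases hl : l = e.1
    · subst hl
      rw [Function.update_self, ← card_slice, ← Finset.card_erase_of_mem (a := e.2)]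
      · congr 1
        ext p
        simp [slice, Sigma.ext_iff, and_comm]
      · simpa [slice] using heT
    · rw [Function.update_of_ne hl, ← card_slice]
      congr 1
      ext p
      simp [slice, Sigma.ext_iff, hl]
  · intro T hT T' hT' h
    have heT := ((Finset.mem_filter.mp hT).2).1
    have heT' := ((Finset.mem_filter.mp hT').2).1
    ext x
    by_cases hx : x = e
    · subst hx
      exact iff_of_true heT heT'
    · have := congrArg (x.2 ∈ ·) (congrFun h x.1)
      simpa [slice, hx] using this

theorem card_filter_isBasisVec_lt_Nbound (e : Σ i : Fin r, Fin (D.rho {i})) :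
    (Finset.univ.filter fun T => e ∈ T ∧ D.IsBasisVec (D.sliceCard T)).card < D.Nbound := by
  rw [Nbound, add_comm, Nat.lt_succ_iff]
  refine le_trans ?_ (Finset.le_sup (Finset.mem_univ e.1))
  rw [Finset.card_eq_sum_card_fiberwise (f := D.sliceCard)
    (t := D.finite.toFinset.filter fun b => D.IsBasisVec b ∧ 0 < b e.1)]
  · refine Finset.sum_le_sum fun b _ => ?_
    refine le_trans (Finset.card_le_card fun T hT => ?_) (D.card_filter_sliceCard_eq_le b e)
    simp only [Finset.mem_filter, Finset.mem_univ, true_and] at hT ⊢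
    exact ⟨hT.1.1, hT.2⟩
  · intro T hT
    obtain ⟨heT, hb⟩ := (Finset.mem_filter.mp hT).2
    refine Finset.mem_coe.mpr
      (Finset.mem_filter.mpr ⟨D.finite.mem_toFinset.mpr hb.1, hb, ?_⟩)
    rw [← card_slice]
    exact Finset.card_pos.mpr ⟨e.2, by simpa [slice] using heT⟩

section Representation

open Module

variable {K W : Type*} [Field K] [AddCommGroup W] [Module K W] [FiniteDimensional K W] {n : ℕ}
  {V : Fin r → Submodule K W}

/-- Blocks of `n` vectors of the spaces of a representation of `nD`, one block for each message
`y_i^p`, such that the blocks of every basis vector are independent. -/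
theorem exists_forall_isBasisVec_linearIndepOn [Fintype K]
    (hV : ∀ X : Set (Fin r), finrank K ↥(⨆ i ∈ X, V i) = n * D.rho X)
    (hcard : D.Nbound < Fintype.card K) :
    ∃ a : (Σ i : Fin r, Fin (D.rho {i})) × Fin n → W, (∀ e, a e ∈ V e.1.1) ∧
      ∀ T, D.IsBasisVec (D.sliceCard T) → LinearIndepOn K a (T ×ˢ Set.univ) := by
  set V' : (Σ i : Fin r, Fin (D.rho {i})) × Fin n → Submodule K W := fun e => V e.1.1 with hV'
  set C : Finset (Set ((Σ i : Fin r, Fin (D.rho {i})) × Fin n)) :=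
    (Finset.univ.filter fun T => D.IsBasisVec (D.sliceCard T)).image (· ×ˢ Set.univ) with hC
  have hrado : ∀ T ∈ C, ∃ w : (Σ i : Fin r, Fin (D.rho {i})) × Fin n → W,
      (∀ e, w e ∈ V' e) ∧ LinearIndepOn K w T := by
    intro T' hT'
    obtain ⟨T, hT, rfl⟩ := Finset.mem_image.mp hT'
    have hb := (Finset.mem_filter.mp hT).2
    suffices hS : ∀ S ⊆ (Finset.univ.filter (· ∈ T)) ×ˢ (Finset.univ : Finset (Fin n)),
        S.card ≤ finrank K ↥(⨆ e ∈ S, V' e) by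
      obtain ⟨w, hw, hwT⟩ := exists_linearIndepOn_of_card_le_finrank _ V' hS
      exact ⟨w, hw, by simpa using hwT⟩
    intro S hS
    set X : Set (Fin r) := {l | ∃ e ∈ S, e.1.1 = l} with hX
    have hsup : (⨆ i ∈ X, V i) = ⨆ e ∈ S, V e.1.1 := by
      refine le_antisymm (iSup₂_le ?_) (iSup₂_le fun e he => ?_)
      · rintro _ ⟨e, he, rfl⟩
        exact le_iSup₂_of_le (f := fun e (_ : e ∈ S) => V e.1.1) e he le_rfl
      · exact le_iSup₂_of_le (f := fun i (_ : i ∈ X) => V i) e.1.1 ⟨e, he, rfl⟩ le_rfl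
    rw [← hsup, hV]
    have hSX : S ⊆ (Finset.univ.filter (· ∈ T ∩ {e | e.1 ∈ X})) ×ˢ
        (Finset.univ : Finset (Fin n)) := fun e he => by
      have := Finset.mem_product.mp (hS he)
      simp only [Finset.mem_product, Finset.mem_filter, Finset.mem_univ, true_and, and_true]
        at this ⊢
      exact ⟨this, e, he, rfl⟩
    refine (Finset.card_le_card hSX).trans ?_
    rw [Finset.card_product, Finset.card_univ, Fintype.card_fin, mul_comm,
      card_eq_sum_sliceCard]
    refine Nat.mul_le_mul_left n (le_trans (le_of_eq ?_) (D.setSum_le_rho hb.1 X))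
    rw [setSum, Finset.sum_filter]
    refine Finset.sum_congr rfl fun l _ => ?_
    simp only [← card_slice]
    split_ifs with hl
    · congr 1
      ext p
      simp [slice, hl]
    · simp [slice, hl]
  have hcount : ∀ e, (C.filter (e ∈ ·)).card < Fintype.card K := by
    rintro ⟨e, s⟩
    refine lt_of_le_of_lt ?_ ((D.card_filter_isBasisVec_lt_Nbound e).trans hcard)
    rw [hC, Finset.filter_image]
    refine Finset.card_image_le.trans (Finset.card_le_card fun T hT => ?_)
    simp only [Finset.mem_filter, Finset.mem_univ, true_and, Set.mem_prod, Set.mem_univ,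
      and_true] at hT ⊢
    exact hT.symm
  obtain ⟨a, ha, hind⟩ := exists_forall_linearIndepOn_of_card_lt V' C hrado hcount
  exact ⟨a, ha, fun T hT => hind _ (Finset.mem_image_of_mem _ (by simpa using hT))⟩

/-- The blocks of a set attaining the rank of `X` span the sum of the spaces indexed by `X`. -/
theorem iSup_le_span_image_of_rho_le
    (hV : ∀ X : Set (Fin r), finrank K ↥(⨆ i ∈ X, V i) = n * D.rho X)
    {a : (Σ i : Fin r, Fin (D.rho {i})) × Fin n → W} (ha : ∀ e, a e ∈ V e.1.1)
    (hind : ∀ T, D.IsBasisVec (D.sliceCard T) → LinearIndepOn K a (T ×ˢ Set.univ))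
    {T : Set (Σ i : Fin r, Fin (D.rho {i}))} (hT : D.sliceCard T ∈ D.carrier)
    {X : Set (Fin r)} (hTX : ∀ e ∈ T, e.1 ∈ X) (hX : D.rho X ≤ ∑ l, D.sliceCard T l) :
    (⨆ i ∈ X, V i) ≤ Submodule.span K (a '' (T ×ˢ Set.univ)) := by
  obtain ⟨T', hTT', hT'⟩ := D.exists_superset_isBasisVec hT
  have hli : LinearIndepOn K a (T ×ˢ Set.univ) :=
    (hind T' hT').mono (Set.prod_mono hTT' subset_rfl)
  have hle : Submodule.span K (a '' (T ×ˢ Set.univ)) ≤ ⨆ i ∈ X, V i := by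
    rw [Submodule.span_le]
    rintro _ ⟨e, he, rfl⟩
    exact (le_iSup₂_of_le (f := fun i (_ : i ∈ X) => V i) e.1.1 (hTX _ he.1) le_rfl) (ha e)
  refine (Submodule.eq_of_le_of_finrank_le hle ?_).ge
  have hfin : finrank K ↥(Submodule.span K (a '' (T ×ˢ Set.univ))) =
      Fintype.card ↥(T ×ˢ (Set.univ : Set (Fin n))) := by
    rw [Set.image_eq_range]
    exact finrank_span_eq_card hli
  rw [hV, hfin, ← Set.toFinset_card, Set.toFinset_prod, Finset.card_product,
    Set.toFinset_univ, Finset.card_univ, Fintype.card_fin, mul_comm]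
  refine Nat.mul_le_mul_right n (hX.trans (le_of_eq ?_))
  rw [← card_eq_sum_sliceCard]
  congr 1
  ext
  simp

/-- A representation of `nD` over a sufficiently large finite field yields a perfect linear index
code. -/
theorem hasLinearIndexCode_of_finrank_eq {K : Type} {W : Type*} [Field K] [Fintype K]
    [AddCommGroup W] [Module K W] [FiniteDimensional K W] {n : ℕ} {V : Fin r → Submodule K W}
    (hV : ∀ X : Set (Fin r), finrank K ↥(⨆ i ∈ X, V i) = n * D.rho X)
    (hcard : D.Nbound < Fintype.card K) :
    HasLinearIndexCode D.indexProblem K n (n * D.indexCodeLen) := by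
  obtain ⟨a, ha, hind⟩ := D.exists_forall_isBasisVec_linearIndepOn hV hcard
  obtain ⟨π, hπ⟩ := (⨆ i ∈ (Set.univ : Set (Fin r)), V i).exists_retraction
  have hdim : finrank K (Fin D.rank → Fin n → K) =
      finrank K (Dual K ↥(⨆ i ∈ (Set.univ : Set (Fin r)), V i)) := by
    rw [Subspace.dual_finrank_eq, hV, finrank_pi_fintype]
    change _ = n * D.rank
    simp [mul_comm]
  let φ := LinearEquiv.ofFinrankEq _ _ hdim
  let f : (D.Msg → Fin n → K) →ₗ[K] ((Σ i : Fin r, Fin (D.rho {i})) × Fin n → K) :=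
    LinearMap.pi fun e =>
      (LinearMap.proj e.2 : (Fin n → K) →ₗ[K] K) ∘ₗ
        (LinearMap.proj (Sum.inr e.1) : (D.Msg → Fin n → K) →ₗ[K] (Fin n → K)) +
      LinearMap.applyₗ (π (a e)) ∘ₗ φ.toLinearMap ∘ₗ LinearMap.funLeft K (Fin n → K) Sum.inl
  have hf : ∀ y e, f y e = y (Sum.inr e.1) e.2 + φ (fun j => y (Sum.inl j)) (π (a e)) :=
    fun _ _ => rfl
  have hspan : ∀ (y : D.Msg → Fin n → K) (T : Set (Σ i : Fin r, Fin (D.rho {i}))),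
      (∀ m ∈ Sum.inr '' T, y m = 0) → f y = 0 →
      ∀ v ∈ Submodule.span K (a '' (T ×ˢ Set.univ)), φ (fun j => y (Sum.inl j)) (π v) = 0 := by
    intro y T hT hfy v hv
    induction hv using Submodule.span_induction with
    | mem v hv =>
      obtain ⟨e, he, rfl⟩ := hv
      have := congrFun hfy e
      rwa [hf, hT _ ⟨e.1, he.1, rfl⟩, Pi.zero_apply, zero_add] at this
    | zero => simp
    | add u v _ _ hu hv => simp [hu, hv]
    | smul t v _ hv => simp [hv]
  refine hasLinearIndexCode_of_forall_eq_zero D.indexProblem K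
    (by simp [indexCodeLen, mul_comm]) f ?_
  rintro p ((⟨b, hb, j, T, hT, rfl⟩ | ⟨c, hc, j, hj, p, T, hT, hTj, -, rfl⟩) | ⟨i, p, rfl⟩)
    y hy hfy
  · have hTb : D.sliceCard T = b := funext hT
    have hle := D.iSup_le_span_image_of_rho_le hV ha hind (T := T) (X := Set.univ)
      (hTb ▸ hb.1) (fun _ _ => Set.mem_univ _) (hTb ▸ hb.rank_le_sum)
    have hφ : φ (fun j => y (Sum.inl j)) = 0 := by
      ext u
      have hu := hspan y T hy hfy u (hle u.2)
      rwa [hπ] at hu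
    exact congrFun (φ.map_eq_zero_iff.mp hφ) j
  · have hTc : D.sliceCard T = Function.update c j (c j - 1) := by
      funext l
      by_cases hl : l = j
      · subst hl
        rw [hTj, Function.update_self]
      · rw [hT l hl, Function.update_of_ne hl]
    have hle := D.iSup_le_span_image_of_rho_le hV ha hind (T := T) (X := {l | c l ≠ 0})
      (hTc ▸ hc.update_mem hj) (fun e he hce => ?_) (by
        have h₁ := hc.rho_support_lt_sum hj
        have h₂ := sum_update_sub_one hj
        rw [hTc]
        omega)
    · funext s
      have hmem : a (⟨j, p⟩, s) ∈ ⨆ i ∈ {l | c l ≠ 0}, V i :=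
        (le_iSup₂_of_le (f := fun i (_ : i ∈ {l | c l ≠ 0}) => V i) j hj le_rfl) (ha (⟨j, p⟩, s))
      have := congrFun hfy (⟨j, p⟩, s)
      rwa [hf, hspan y T hy hfy _ (hle hmem), add_zero] at this
    · have hpos : 0 < D.sliceCard T e.1 := by
        rw [← D.card_slice]
        exact Finset.card_pos.mpr ⟨e.2, by simpa [slice] using he⟩
      have hlc : D.sliceCard T e.1 ≤ c e.1 := by
        rw [hTc]
        exact update_le_self_iff.mpr (Nat.sub_le _ _) e.1
      omega
  · have hx : (fun j => y (Sum.inl j)) = (0 : Fin D.rank → Fin n → K) :=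
      funext fun j => hy _ ⟨j, rfl⟩
    funext s
    have := congrFun hfy (⟨i, p⟩, s)
    simpa [hf, hx] using this

end Representation

end DiscretePolymatroid

/-- **Theorem 8.** If the discrete polymatroid `nD` is representable over `F_q`, then for
every extension field `F_{q'}` of `F_q` of size `q' > N(D)`, a perfect linear index coding
solution of dimension `n` exists over `F_{q'}` for the index coding problem `I^D(Z,R)`. -/
theorem perfectLinearIndexCode_of_representable
    {r : ℕ} (hr : 0 < r) (D : DiscretePolymatroid r) (n : ℕ) (hn : 0 < n)
    (F : Type) [Field F] [Fintype F]
    (h : RepFnOver r (fun X => n * D.rho X) F)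
    (F' : Type) [Field F'] [Fintype F'] [Algebra F F']
    (hcard : D.Nbound < Fintype.card F') :
    HasLinearIndexCode D.indexProblem F' n (n * D.indexCodeLen) := by
  obtain ⟨d, V, hV⟩ := h
  exact D.hasLinearIndexCode_of_finrank_eq (V := fun i => (V i).baseChange F')
    (fun X => (finrank_iSup_baseChange V X).trans (hV X)) hcard
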